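/- Let t ∈ PT_n and let P = P_t be the standard weight Loday realization of the operahedron. Then representatives for the equivalence classes (up to nonzero scalar multiple) of directions of the edges of P ∩ ρ_zP, over all z ∈ P, are given by trinary vectors of ℝ^{n−1} (vectors with coordinates in {0, 1, −1}) having the same number of coordinates equal to 1 and to −1 and whose first nonzero coordinate is 1. -/

import Mathlib

open scoped BigOperators

noncomputable section

/-- Vectors in `ℝⁿ`. -/
abbrev Vec (n : ℕ) := Fin n → ℝ

/-- The standard scalar product on `ℝⁿ`. -/
def dot {n : ℕ} (x y : Vec n) : ℝ := ∑ i, x i * y i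

/-- A polytope is the convex hull of a finite set of points. -/
def IsPolytope {n : ℕ} (P : Set (Vec n)) : Prop :=
  ∃ S : Finset (Vec n), P = convexHull ℝ (S : Set (Vec n))

/-- A face of `P`: either `P` itself (take `c = 0`) or the subset of `P` where some linear
functional attains its maximum over `P`. -/
def IsFace {n : ℕ} (P F : Set (Vec n)) : Prop :=
  ∃ c : Vec n, F = {x ∈ P | ∀ y ∈ P, dot c y ≤ dot c x}

/-- Dimension of a subset of `ℝⁿ`: the rank of the direction of its affine span. -/
noncomputable def sdim {n : ℕ} (A : Set (Vec n)) : ℕ :=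
  Module.finrank ℝ (affineSpan ℝ A).direction

/-- The normal cone of a face `F` of `P`. -/
def normalCone {n : ℕ} (P F : Set (Vec n)) : Set (Vec n) :=
  {c | F ⊆ {x ∈ P | ∀ y ∈ P, dot c y ≤ dot c x}}

/-- `coneOf X`: nonnegative linear combinations of finitely many elements of `X`. -/
def coneOf {n : ℕ} (X : Set (Vec n)) : Set (Vec n) :=
  {v | ∃ (k : ℕ) (x : Fin k → Vec n) (l : Fin k → ℝ),
      (∀ i, x i ∈ X) ∧ (∀ i, 0 ≤ l i) ∧ v = ∑ i, l i • x i}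

/-- The reflection `ρ_z P = 2z - P` of `P` with respect to `z`. -/
def reflP {n : ℕ} (z : Vec n) (P : Set (Vec n)) : Set (Vec n) :=
  (fun x => (2 : ℝ) • z - x) '' P

/-- An edge is a 1-dimensional face. -/
def IsEdge {n : ℕ} (P E : Set (Vec n)) : Prop := IsFace P E ∧ sdim E = 1

/-- `(P, v)` is oriented if `v` is not perpendicular to any edge of `P`. -/
def Oriented {n : ℕ} (P : Set (Vec n)) (v : Vec n) : Prop :=
  ∀ E, IsEdge P E → ∀ d ∈ (affineSpan ℝ E).direction, d ≠ 0 → dot d v ≠ 0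

/-- `(P, v)` is positively oriented if `(P ∩ ρ_z P, v)` is oriented for every `z ∈ P`. -/
def PosOriented {n : ℕ} (P : Set (Vec n)) (v : Vec n) : Prop :=
  ∀ z ∈ P, Oriented (P ∩ reflP z P) v

/-- `x` is the minimizer of `⟨-, v⟩` on `P`. -/
def IsBotOf {n : ℕ} (P : Set (Vec n)) (v x : Vec n) : Prop :=
  x ∈ P ∧ ∀ y ∈ P, dot v x ≤ dot v y

/-- `x` is the maximizer of `⟨-, v⟩` on `P`. -/
def IsTopOf {n : ℕ} (P : Set (Vec n)) (v x : Vec n) : Prop :=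
  x ∈ P ∧ ∀ y ∈ P, dot v y ≤ dot v x

/-- `(P, v)` is quasi-oriented if `⟨-, v⟩` has a unique minimizer and a unique maximizer on `P`. -/
def QuasiOriented {n : ℕ} (P : Set (Vec n)) (v : Vec n) : Prop :=
  (∃! x, IsBotOf P v x) ∧ (∃! x, IsTopOf P v x)

/-- `(P, v)` is quasi-positively oriented if `(P ∩ ρ_z P, v)` is quasi-oriented for all `z ∈ P`. -/
def QuasiPosOriented {n : ℕ} (P : Set (Vec n)) (v : Vec n) : Prop :=
  ∀ z ∈ P, QuasiOriented (P ∩ reflP z P) v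

/-- The polytope `P^φ = π^φ(P × P) ⊆ ℝ^{n+1}`, where `π^φ(x,y) = ((x+y)/2, ⟨x - y, v⟩)`. -/
def Pphi {n : ℕ} (P : Set (Vec n)) (v : Vec n) : Set (Vec (n + 1)) :=
  {w | ∃ x ∈ P, ∃ y ∈ P, w = Fin.snoc ((1 / 2 : ℝ) • (x + y)) (dot (x - y) v)}

/-- The pair of faces `(F, G)` belongs to `F^φ`: there are no `x ∈ F`, `y ∈ G`, `λ > 0` with
`(π(x,y), φ(x,y) - λ) ∈ P^φ`. -/
def InFphi {n : ℕ} (P : Set (Vec n)) (v : Vec n) (F G : Set (Vec n)) : Prop :=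
  ¬ ∃ x ∈ F, ∃ y ∈ G, ∃ lam : ℝ, 0 < lam ∧
      (Fin.snoc ((1 / 2 : ℝ) • (x + y)) (dot (x - y) v - lam) : Vec (n + 1)) ∈ Pphi P v

/-- The set `(A + B)/2`. -/
def avgSet {n : ℕ} (A B : Set (Vec n)) : Set (Vec n) :=
  {z | ∃ x ∈ A, ∃ y ∈ B, z = (1 / 2 : ℝ) • (x + y)}

/-- The coherent subdivision `π(F^φ)` is tight. -/
def TightSub {n : ℕ} (P : Set (Vec n)) (v : Vec n) : Prop :=
  ∀ F G : Set (Vec n), IsFace P F → IsFace P G → F.Nonempty → G.Nonempty →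
    InFphi P v F G → sdim F + sdim G = sdim (avgSet F G)

/-- `d` is a direction of an edge of `P ∩ ρ_z P` for some `z ∈ P`; the hyperplanes of the
fundamental hyperplane arrangement `H_P` are the orthogonal complements of such directions. -/
def EdgeDir {n : ℕ} (P : Set (Vec n)) (d : Vec n) : Prop :=
  d ≠ 0 ∧ ∃ z ∈ P, ∃ E, IsEdge (P ∩ reflP z P) E ∧ d ∈ (affineSpan ℝ E).direction

/-- The cone `cone(-N_P(F) ∪ N_P(G))`. -/
def diagCone {n : ℕ} (P F G : Set (Vec n)) : Set (Vec n) :=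
  coneOf ((Neg.neg '' normalCone P F) ∪ normalCone P G)


/-- A planar rooted tree with `n` internal vertices labelled `0, …, n-1` in the clockwise-from-root
(depth-first preorder) order; `parent v` is the parent of the vertex `v`, the root being vertex `0`.
The internal edge `e : Fin (n-1)` connects the vertex `e+1` to its parent. -/
structure PTree (n : ℕ) where
  parent : Fin n → Fin n
  parent_zero : ∀ v : Fin n, v.val = 0 → parent v = v
  parent_lt : ∀ v : Fin n, 0 < v.val → (parent v).val < v.val
  preorder : ∀ v w : Fin n, w.val = v.val + 1 → ∃ k : ℕ, parent^[k] v = parent w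

/-- The child endpoint of the edge `e`: the vertex labelled `e + 1`. -/
def childV {n : ℕ} (e : Fin (n - 1)) : Fin n :=
  ⟨e.val + 1, by have h := e.isLt; omega⟩

/-- The vertices of the closure of a set of edges `N`, i.e. `V(t(N))`. -/
def nestVtx {n : ℕ} (t : PTree n) (N : Finset (Fin (n - 1))) : Finset (Fin n) :=
  N.biUnion fun e => {childV e, t.parent (childV e)}

/-- Two distinct edges are adjacent when they share a vertex. -/
def edgeAdj {n : ℕ} (t : PTree n) (e f : Fin (n - 1)) : Prop :=
  e ≠ f ∧ (({childV e, t.parent (childV e)} ∩ {childV f, t.parent (childV f)} :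
      Finset (Fin n))).Nonempty

instance {n : ℕ} (t : PTree n) (e f : Fin (n - 1)) : Decidable (edgeAdj t e f) := by
  unfold edgeAdj; infer_instance

/-- A nest: a set of edges whose closure is a connected subgraph (the trivial nest `E(t)` is
also allowed when `n = 1`, where it is empty). -/
def IsNest {n : ℕ} (t : PTree n) (N : Finset (Fin (n - 1))) : Prop :=
  (N.Nonempty ∨ N = Finset.univ) ∧
    ∀ e ∈ N, ∀ f ∈ N,
      Relation.ReflTransGen (fun a b => a ∈ N ∧ b ∈ N ∧ edgeAdj t a b) e f

/-- A nesting: a set of nests containing the trivial nest, any two of which are nested or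
disjoint, disjoint ones having no adjacent edges. -/
def IsNesting {n : ℕ} (t : PTree n) (𝒩 : Finset (Finset (Fin (n - 1)))) : Prop :=
  (∀ N ∈ 𝒩, IsNest t N) ∧ Finset.univ ∈ 𝒩 ∧
    ∀ N ∈ 𝒩, ∀ M ∈ 𝒩,
      N ⊆ M ∨ M ⊆ N ∨ (Disjoint N M ∧ ∀ e ∈ N, ∀ f ∈ M, ¬ edgeAdj t e f)

/-- A maximal nesting: a nesting of (maximal) cardinality `n - 1`. -/
def IsMaxNesting {n : ℕ} (t : PTree n) (𝒩 : Finset (Finset (Fin (n - 1)))) : Prop :=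
  IsNesting t 𝒩 ∧ 𝒩.card = n - 1

/-- `min 𝒩(i)`: the smallest nest of `𝒩` containing the edge `i` (the nests of a nesting
containing `i` being totally ordered, this is their intersection). -/
def minNest {n : ℕ} (𝒩 : Finset (Finset (Fin (n - 1)))) (i : Fin (n - 1)) :
    Finset (Fin (n - 1)) :=
  (𝒩.filter fun N => i ∈ N).inf id

/-- `u` is a weak ancestor of `w` (any ancestor is reached in at most `n` steps). -/
def isAnc {n : ℕ} (t : PTree n) (u w : Fin n) : Prop :=
  ∃ k ∈ Finset.range (n + 1), t.parent^[k] w = u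

instance {n : ℕ} (t : PTree n) (u w : Fin n) : Decidable (isAnc t u w) := by
  unfold isAnc; infer_instance

/-- `α_i`: the total weight of the subtree `t₁` of `t(min𝒩(i))` having the edge `i` as root. -/
def alphaN {n : ℕ} (t : PTree n) (𝒩 : Finset (Finset (Fin (n - 1))))
    (ω : Fin n → ℤ) (i : Fin (n - 1)) : ℤ :=
  ∑ w ∈ (nestVtx t (minNest 𝒩 i)).filter (fun w => isAnc t (childV i) w), ω w

/-- `β_i`: the total weight of the subtree `t₂` of `t(min𝒩(i))` having the edge `i` as a leaf. -/
def betaN {n : ℕ} (t : PTree n) (𝒩 : Finset (Finset (Fin (n - 1))))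
    (ω : Fin n → ℤ) (i : Fin (n - 1)) : ℤ :=
  ∑ w ∈ (nestVtx t (minNest 𝒩 i)).filter (fun w => ¬ isAnc t (childV i) w), ω w

/-- The point `M(t, 𝒩, ω) = (α₁β₁, …, α_{n-1}β_{n-1})`. -/
noncomputable def MPoint {n : ℕ} (t : PTree n) (𝒩 : Finset (Finset (Fin (n - 1))))
    (ω : Fin n → ℤ) : Vec (n - 1) :=
  fun i => ((alphaN t 𝒩 ω i : ℤ) : ℝ) * ((betaN t 𝒩 ω i : ℤ) : ℝ)

/-- The Loday realization `P_{(t,ω)}` of the operahedron. -/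
noncomputable def Loday {n : ℕ} (t : PTree n) (ω : Fin n → ℤ) : Set (Vec (n - 1)) :=
  convexHull ℝ {x | ∃ 𝒩, IsMaxNesting t 𝒩 ∧ x = MPoint t 𝒩 ω}

/-- The face of `P_{(t,ω)}` associated to a nesting `𝒩`: the convex hull of the points
`M(t,𝒩',ω)` over the maximal nestings `𝒩' ⊇ 𝒩`. -/
noncomputable def faceOfNesting {n : ℕ} (t : PTree n) (ω : Fin n → ℤ)
    (𝒩 : Finset (Finset (Fin (n - 1)))) : Set (Vec (n - 1)) :=
  convexHull ℝ {x | ∃ 𝒩', IsMaxNesting t 𝒩' ∧ 𝒩 ⊆ 𝒩' ∧ x = MPoint t 𝒩' ω}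

/-- A pair `(I, J) ∈ D(m)`: disjoint subsets of the same cardinality with `min (I ∪ J) ∈ I`. -/
def DPair {m : ℕ} (I J : Finset (Fin m)) : Prop :=
  I.card = J.card ∧ Disjoint I J ∧ ∃ i ∈ I, ∀ x ∈ I ∪ J, i ≤ x

/-- A trinary vector: all coordinates are `0`, `1` or `-1`. -/
def Trinary {m : ℕ} (u : Vec m) : Prop := ∀ i, u i = 0 ∨ u i = 1 ∨ u i = -1

/-- A balanced vector: same number of coordinates equal to `1` and to `-1`. -/
def BalancedVec {m : ℕ} (u : Vec m) : Prop :=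
  (Finset.univ.filter fun i => u i = 1).card = (Finset.univ.filter fun i => u i = -1).card

/-- The first nonzero coordinate is `1`. -/
def FirstPos {m : ℕ} (u : Vec m) : Prop :=
  ∀ i, u i ≠ 0 → (∀ j, j < i → u j = 0) → u i = 1

/-- A nonzero vector with zero sums over the classes of two partitions forces a nonzero trinary
vector with the same property. -/
lemma exists_trinary_of_sum_fiber_eq_zero {m : ℕ} {A B : Type*} [DecidableEq A] [DecidableEq B]
    (p : Fin m → A) (q : Fin m → B) {d : Vec m} (hd : d ≠ 0)
    (hp : ∀ a, ∑ i with p i = a, d i = 0) (hq : ∀ b, ∑ i with q i = b, d i = 0) :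
    ∃ u : Vec m, u ≠ 0 ∧ Trinary u ∧ (∀ a, ∑ i with p i = a, u i = 0) ∧
      ∀ b, ∑ i with q i = b, u i = 0 := by
  have hneg : ∀ i, 0 < d i → ∃ j, q j = q i ∧ d j < 0 := by
    intro i hi
    by_contra! h
    refine (Finset.sum_pos' (s := Finset.univ.filter fun j => q j = q i) (f := d) ?_
      ⟨i, by simp, hi⟩).ne' (hq (q i))
    simpa using h
  have hpos : ∀ i, d i < 0 → ∃ j, p j = p i ∧ 0 < d j := by
    intro i hi
    by_contra! h
    refine (Finset.sum_neg' (s := Finset.univ.filter fun j => p j = p i) (f := d) ?_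
      ⟨i, by simp, hi⟩).ne (hp (p i))
    simpa using h
  choose! h hhq hhd using hneg
  choose! k hkp hkd using hpos
  obtain ⟨i₀, hi₀⟩ : ∃ i, 0 < d i := by
    obtain ⟨i, hi⟩ := Function.ne_iff.1 hd
    rcases lt_or_gt_of_ne hi with hi | hi
    · exact ⟨k i, hkd i hi⟩
    · exact ⟨i, hi⟩
  let g : {i // 0 < d i} → {i // 0 < d i} := fun i => ⟨k (h i), hkd _ (hhd _ i.2)⟩
  classical
  let O : Finset {i // 0 < d i} := Finset.univ.filter fun i => i ∈ Function.periodicPts g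
  have hO : (O : Set {i // 0 < d i}) = Function.periodicPts g := by ext; simp [O]
  have hbij : Set.BijOn g O O := hO ▸ Function.bijOn_periodicPts g
  obtain ⟨i₁, hi₁⟩ : O.Nonempty := by
    obtain ⟨a, b, hab, heq⟩ := Finite.exists_ne_map_eq_of_infinite
      (fun s : ℕ => g^[s] ⟨i₀, hi₀⟩)
    wlog hlt : a < b generalizing a b
    · exact this b a hab.symm heq.symm (by omega)
    refine ⟨g^[a] ⟨i₀, hi₀⟩, ?_⟩
    rw [← Finset.mem_coe, hO]
    refine ⟨b - a, by omega, ?_⟩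
    change g^[b - a] (g^[a] _) = _
    rw [← Function.iterate_add_apply, Nat.sub_add_cancel hlt.le]
    exact heq.symm
  let X : Finset (Fin m) := O.image fun i => i.1
  let Y : Finset (Fin m) := O.image fun i => h i.1
  have hX : ∀ i ∈ X, 0 < d i := by
    intro i hi
    obtain ⟨j, -, rfl⟩ := Finset.mem_image.1 hi
    exact j.2
  have hY : ∀ i ∈ Y, d i < 0 := by
    intro i hi
    obtain ⟨j, -, rfl⟩ := Finset.mem_image.1 hi
    exact hhd _ j.2
  have hinjh : Set.InjOn (fun i : {i // 0 < d i} => h i.1) O := by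
    intro a ha b hb hab
    exact hbij.injOn ha hb (Subtype.ext (congrArg k hab))
  let u : Vec m := fun i => (if i ∈ X then 1 else 0) - (if i ∈ Y then 1 else 0)
  have hsum : ∀ s : Finset (Fin m), ∑ i ∈ s, u i =
      ∑ i ∈ O, (if i.1 ∈ s then 1 else 0) - ∑ i ∈ O, (if h i.1 ∈ s then 1 else 0) := by
    intro s
    have e1 : ∑ i ∈ O, (if i.1 ∈ s then (1 : ℝ) else 0) = ∑ i ∈ X, if i ∈ s then 1 else 0 :=
      (Finset.sum_image (f := fun i => if i ∈ s then (1 : ℝ) else 0)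
        (Subtype.val_injective.injOn)).symm
    have e2 : ∑ i ∈ O, (if h i.1 ∈ s then (1 : ℝ) else 0) = ∑ i ∈ Y, if i ∈ s then 1 else 0 :=
      (Finset.sum_image (f := fun i => if i ∈ s then (1 : ℝ) else 0) hinjh).symm
    rw [e1, e2]
    simp only [u, Finset.sum_sub_distrib, Finset.sum_ite_mem, Finset.inter_comm]
  refine ⟨u, ?_, ?_, ?_, ?_⟩
  · refine Function.ne_iff.2 ⟨i₁.1, ?_⟩
    have h1 : i₁.1 ∈ X := Finset.mem_image_of_mem _ hi₁
    have h2 : i₁.1 ∉ Y := fun h' => absurd (hY _ h') (not_lt.2 i₁.2.le)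
    simp [u, h1, h2]
  · intro i
    simp only [u]
    by_cases h1 : i ∈ X
    · have h2 : i ∉ Y := fun h' => absurd (hY _ h') (not_lt.2 (hX i h1).le)
      simp [h1, h2]
    · by_cases h2 : i ∈ Y <;> simp [h1, h2]
  · intro a
    rw [hsum, sub_eq_zero]
    simp only [Finset.mem_filter, Finset.mem_univ, true_and]
    symm
    refine Finset.sum_nbij g hbij.mapsTo hbij.injOn hbij.surjOn fun i _ => ?_
    simp [g, hkp _ (hhd i.1 i.2)]
  · intro b
    rw [hsum, sub_eq_zero]
    refine Finset.sum_congr rfl fun i _ => ?_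
    simp [hhq i.1 i.2]

/-- A trinary vector with zero sum is balanced. -/
lemma balancedVec_of_sum_eq_zero {m : ℕ} {u : Vec m} (hu : Trinary u) (hs : ∑ i, u i = 0) :
    BalancedVec u := by
  have key : ∀ i, u i = (if u i = 1 then 1 else 0) - (if u i = -1 then 1 else 0) := by
    intro i
    rcases hu i with h | h | h <;> rw [h] <;> norm_num
  rw [Finset.sum_congr rfl fun i _ => key i, Finset.sum_sub_distrib, Finset.sum_boole,
    Finset.sum_boole, sub_eq_zero] at hs
  exact Nat.cast_injective hs

lemma Trinary.neg {m : ℕ} {u : Vec m} (hu : Trinary u) : Trinary (-u) := by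
  intro i
  rcases hu i with h | h | h <;> simp [h]

lemma Trinary.firstPos_or_firstPos_neg {m : ℕ} {u : Vec m} (hu : Trinary u) :
    FirstPos u ∨ FirstPos (-u) := by
  by_contra! h
  simp only [FirstPos, not_forall] at h
  obtain ⟨⟨i, hi, hlt, hi1⟩, j, hj, hlt', hj1⟩ := h
  simp only [Pi.neg_apply, ne_eq, neg_eq_zero] at hj hlt' hj1
  have hij : i = j := by
    rcases lt_trichotomy i j with h | h | h
    · exact absurd (hlt' i h) hi
    · exact h
    · exact absurd (hlt j h) hj
  subst hij
  rcases hu i with h | h | h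
  · exact hi h
  · exact hi1 h
  · exact hj1 (by rw [h, neg_neg])

namespace PTree

variable {n : ℕ} {t : PTree n}

section Ancestors

lemma parent_iterate_le (t : PTree n) (w : Fin n) (k : ℕ) :
    (t.parent^[k] w).val ≤ w.val - k := by
  induction k with
  | zero => simp
  | succ k ih =>
    rw [Function.iterate_succ_apply']
    rcases Nat.eq_zero_or_pos (t.parent^[k] w).val with h | h
    · rw [t.parent_zero _ h]; omega
    · have := t.parent_lt _ h; omega

lemma isAnc_iff {u w : Fin n} : isAnc t u w ↔ ∃ k : ℕ, t.parent^[k] w = u := by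
  constructor
  · rintro ⟨k, -, hk⟩
    exact ⟨k, hk⟩
  · rintro ⟨k, hk⟩
    rcases le_or_gt k n with h | h
    · exact ⟨k, Finset.mem_range.2 (by omega), hk⟩
    · refine ⟨n, Finset.mem_range.2 (by omega), ?_⟩
      rw [← hk]
      apply Fin.ext
      have h1 := t.parent_iterate_le w n
      have h2 := t.parent_iterate_le w k
      have := w.isLt
      omega

lemma le_of_isAnc {u w : Fin n} (h : isAnc t u w) : u ≤ w := by
  obtain ⟨k, hk⟩ := isAnc_iff.1 h
  have := t.parent_iterate_le w k
  rw [hk] at this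
  exact Fin.le_def.2 (by omega)

lemma isAnc_iff_eq_or_parent {u w : Fin n} :
    isAnc t u w ↔ u = w ∨ isAnc t u (t.parent w) := by
  rw [isAnc_iff, isAnc_iff]
  constructor
  · rintro ⟨k, hk⟩
    cases k with
    | zero => exact Or.inl hk.symm
    | succ k => exact Or.inr ⟨k, hk⟩
  · rintro (h | ⟨k, hk⟩)
    · exact ⟨0, h.symm⟩
    · exact ⟨k + 1, hk⟩

lemma childV_injective : Function.Injective (childV : Fin (n - 1) → Fin n) := by
  intro a b h
  have := congrArg Fin.val h
  simp only [childV] at this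
  exact Fin.ext (by omega)

lemma exists_childV_eq {v : Fin n} (hv : 0 < v.val) : ∃ e : Fin (n - 1), childV e = v :=
  ⟨⟨v.val - 1, by have := v.isLt; omega⟩, Fin.ext (by simp only [childV]; omega)⟩

lemma parent_childV_lt (e : Fin (n - 1)) : t.parent (childV e) < childV e :=
  Fin.lt_def.2 (t.parent_lt _ (by simp [childV]))

end Ancestors

section Paths

/-- The edges separating `u` from `w`, i.e. the path between `u` and `w`. -/
def path (t : PTree n) (u w : Fin n) : Finset (Fin (n - 1)) :=
  Finset.univ.filter fun i => ¬ (isAnc t (childV i) u ↔ isAnc t (childV i) w)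

lemma mem_path {u w : Fin n} {i : Fin (n - 1)} :
    i ∈ t.path u w ↔ ¬ (isAnc t (childV i) u ↔ isAnc t (childV i) w) := by
  simp [path]

lemma path_comm (u w : Fin n) : t.path u w = t.path w u := by
  ext i
  rw [mem_path, mem_path, iff_comm (a := isAnc t _ u)]

lemma path_self (u : Fin n) : t.path u u = ∅ := by
  ext i
  simp [mem_path]

lemma path_childV (e : Fin (n - 1)) {w : Fin n} (hw : w < childV e) :
    t.path (childV e) w = insert e (t.path (t.parent (childV e)) w) := by
  ext i
  rw [Finset.mem_insert, mem_path, mem_path, isAnc_iff_eq_or_parent (w := childV e)]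
  rcases eq_or_ne i e with rfl | h
  · have : ¬ isAnc t (childV i) w := fun h => absurd (le_of_isAnc h) (not_le.2 hw)
    simp [this]
  · have : childV i ≠ childV e := fun h' => h (childV_injective h')
    simp [h, this]

/-- Connectedness of the closure of a set of edges. -/
def Conn (t : PTree n) (N : Finset (Fin (n - 1))) : Prop :=
  ∀ e ∈ N, ∀ f ∈ N,
    Relation.ReflTransGen (fun a b => a ∈ N ∧ b ∈ N ∧ edgeAdj t a b) e f

lemma edgeAdj_symm {e f : Fin (n - 1)} (h : edgeAdj t e f) : edgeAdj t f e :=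
  ⟨h.1.symm, by rw [Finset.inter_comm]; exact h.2⟩

lemma mem_nestVtx {N : Finset (Fin (n - 1))} {v : Fin n} :
    v ∈ nestVtx t N ↔ ∃ e ∈ N, v = childV e ∨ v = t.parent (childV e) := by
  simp [nestVtx]

lemma nestVtx_mono {N M : Finset (Fin (n - 1))} (h : N ⊆ M) : nestVtx t N ⊆ nestVtx t M :=
  Finset.biUnion_subset_biUnion_of_subset_left _ h

lemma eq_or_edgeAdj {e f : Fin (n - 1)} {v : Fin n}
    (he : v = childV e ∨ v = t.parent (childV e))
    (hf : v = childV f ∨ v = t.parent (childV f)) : e = f ∨ edgeAdj t e f := by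
  by_cases h : e = f
  · exact Or.inl h
  · exact Or.inr ⟨h, v, by simp [he, hf]⟩

lemma conn_singleton (e : Fin (n - 1)) : t.Conn {e} := by
  intro a ha b hb
  rw [Finset.mem_singleton] at ha hb
  rw [ha, hb]

lemma reach_mono {N M : Finset (Fin (n - 1))} (hNM : N ⊆ M) {e f : Fin (n - 1)}
    (h : Relation.ReflTransGen (fun a b => a ∈ N ∧ b ∈ N ∧ edgeAdj t a b) e f) :
    Relation.ReflTransGen (fun a b => a ∈ M ∧ b ∈ M ∧ edgeAdj t a b) e f :=
  Relation.ReflTransGen.mono (fun _ _ h => ⟨hNM h.1, hNM h.2.1, h.2.2⟩) e f h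

lemma reach_symm {N : Finset (Fin (n - 1))} {e f : Fin (n - 1)}
    (h : Relation.ReflTransGen (fun a b => a ∈ N ∧ b ∈ N ∧ edgeAdj t a b) e f) :
    Relation.ReflTransGen (fun a b => a ∈ N ∧ b ∈ N ∧ edgeAdj t a b) f e := by
  induction h with
  | refl => exact .refl
  | tail _ h ih => exact .head ⟨h.2.1, h.1, edgeAdj_symm h.2.2⟩ ih

lemma Conn.union {N M : Finset (Fin (n - 1))} (hN : t.Conn N) (hM : t.Conn M)
    {e f : Fin (n - 1)} (he : e ∈ N) (hf : f ∈ M) (hef : e = f ∨ edgeAdj t e f) :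
    t.Conn (N ∪ M) := by
  have hNl : N ⊆ N ∪ M := Finset.subset_union_left
  have hMr : M ⊆ N ∪ M := Finset.subset_union_right
  have cross : ∀ a ∈ N, ∀ b ∈ M, Relation.ReflTransGen
      (fun a b => a ∈ N ∪ M ∧ b ∈ N ∪ M ∧ edgeAdj t a b) a b := by
    intro a ha b hb
    refine (reach_mono hNl (hN a ha e he)).trans (.trans ?_ (reach_mono hMr (hM f hf b hb)))
    rcases hef with rfl | h
    · exact .refl
    · exact .single ⟨hNl he, hMr hf, h⟩
  intro a ha b hb
  rcases Finset.mem_union.1 ha with ha | ha <;> rcases Finset.mem_union.1 hb with hb | hb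
  · exact reach_mono hNl (hN a ha b hb)
  · exact cross a ha b hb
  · exact reach_symm (cross b hb a ha)
  · exact reach_mono hMr (hM a ha b hb)

lemma path_spec {u w : Fin n} (huw : u ≠ w) :
    u ∈ nestVtx t (t.path u w) ∧ w ∈ nestVtx t (t.path u w) ∧ t.Conn (t.path u w) := by
  induction hk : u.val + w.val using Nat.strong_induction_on generalizing u w with
  | _ k ih =>
  subst hk
  wlog h : w < u generalizing u w
  · have hlt : u < w := lt_of_le_of_ne (not_lt.1 h) huw
    obtain ⟨h1, h2, h3⟩ := this huw.symm (fun m hm u w h h' => ih m (by omega) h h') hlt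
    rw [path_comm]
    exact ⟨h2, h1, h3⟩
  obtain ⟨e, rfl⟩ := exists_childV_eq (v := u) (by have := Fin.lt_def.1 h; omega)
  rw [path_childV e h]
  have hu : childV e ∈ nestVtx t (insert e (t.path (t.parent (childV e)) w)) :=
    mem_nestVtx.2 ⟨e, Finset.mem_insert_self _ _, Or.inl rfl⟩
  refine ⟨hu, ?_⟩
  by_cases hp : t.parent (childV e) = w
  · rw [hp, path_self]
    exact ⟨mem_nestVtx.2 ⟨e, by simp, Or.inr hp.symm⟩, by simpa using conn_singleton e⟩
  · obtain ⟨h1, h2, h3⟩ := ih _ (by have := Fin.lt_def.1 (t.parent_childV_lt e); omega) hp rfl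
    refine ⟨nestVtx_mono (Finset.subset_insert _ _) h2, ?_⟩
    obtain ⟨f, hf, hf'⟩ := mem_nestVtx.1 h1
    rw [Finset.insert_eq]
    exact (conn_singleton e).union h3 (Finset.mem_singleton_self e) hf
      (eq_or_edgeAdj (Or.inr rfl) hf')

lemma Conn.path_subset {N : Finset (Fin (n - 1))} (hN : t.Conn N) {u w : Fin n}
    (hu : u ∈ nestVtx t N) (hw : w ∈ nestVtx t N) : t.path u w ⊆ N := by
  intro i hi
  by_contra hiN
  rw [mem_path] at hi
  have side : ∀ e ∈ N, ∀ v, (v = childV e ∨ v = t.parent (childV e)) →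
      (isAnc t (childV i) v ↔ isAnc t (childV i) (childV e)) := by
    rintro e he v (rfl | rfl)
    · rfl
    · rw [isAnc_iff_eq_or_parent (w := childV e)]
      have : childV i ≠ childV e := fun h => hiN (childV_injective h ▸ he)
      simp [this]
  have same : ∀ e f, Relation.ReflTransGen (fun a b => a ∈ N ∧ b ∈ N ∧ edgeAdj t a b) e f →
      (isAnc t (childV i) (childV e) ↔ isAnc t (childV i) (childV f)) := by
    intro e f h
    induction h with
    | refl => rfl
    | tail _ h ih =>
      obtain ⟨ha, hb, -, v, hv⟩ := h
      simp only [Finset.mem_inter, Finset.mem_insert, Finset.mem_singleton] at hv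
      rw [ih, ← side _ ha v hv.1, side _ hb v hv.2]
  obtain ⟨e, he, hue⟩ := mem_nestVtx.1 hu
  obtain ⟨f, hf, hwf⟩ := mem_nestVtx.1 hw
  exact hi (by rw [side e he u hue, side f hf w hwf]; exact same e f (hN e he f hf))

lemma conn_of_path_subset {N : Finset (Fin (n - 1))}
    (h : ∀ u ∈ nestVtx t N, ∀ w ∈ nestVtx t N, t.path u w ⊆ N) : t.Conn N := by
  intro e he f hf
  rcases eq_or_ne e f with rfl | hne
  · exact .refl
  obtain ⟨h1, h2, h3⟩ := path_spec (t := t) (fun h' => hne (childV_injective h'))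
  obtain ⟨a, ha, ha'⟩ := mem_nestVtx.1 h1
  obtain ⟨b, hb, hb'⟩ := mem_nestVtx.1 h2
  have hsub := h _ (mem_nestVtx.2 ⟨e, he, Or.inl rfl⟩) _ (mem_nestVtx.2 ⟨f, hf, Or.inl rfl⟩)
  have hc := ((conn_singleton e).union h3 (Finset.mem_singleton_self e) ha
    (eq_or_edgeAdj (Or.inl rfl) ha')).union (conn_singleton f)
    (Finset.mem_union_right _ hb) (Finset.mem_singleton_self f) (eq_or_edgeAdj hb' (Or.inl rfl))
  refine reach_mono ?_ (hc e (by simp) f (by simp))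
  intro i hi
  simp only [Finset.mem_union, Finset.mem_singleton] at hi
  rcases hi with (rfl | hi) | rfl
  exacts [he, hsub hi, hf]

lemma conn_univ : t.Conn Finset.univ :=
  conn_of_path_subset fun _ _ _ _ => Finset.subset_univ _

lemma Conn.inter {N M : Finset (Fin (n - 1))} (hN : t.Conn N) (hM : t.Conn M) :
    t.Conn (N ∩ M) :=
  conn_of_path_subset fun _ hu _ hw => Finset.subset_inter
    (hN.path_subset (nestVtx_mono Finset.inter_subset_left hu)
      (nestVtx_mono Finset.inter_subset_left hw))
    (hM.path_subset (nestVtx_mono Finset.inter_subset_right hu)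
      (nestVtx_mono Finset.inter_subset_right hw))

lemma Conn.card_nestVtx {N : Finset (Fin (n - 1))} (hN : t.Conn N) (hne : N.Nonempty) :
    (nestVtx t N).card = N.card + 1 := by
  have hV : (nestVtx t N).Nonempty := by
    obtain ⟨e, he⟩ := hne
    exact ⟨childV e, mem_nestVtx.2 ⟨e, he, Or.inl rfl⟩⟩
  obtain ⟨r, hr, hmin⟩ := (nestVtx t N).exists_min_image id hV
  have hrN : r ∉ N.image childV := by
    intro h
    obtain ⟨e, he, rfl⟩ := Finset.mem_image.1 h
    exact absurd (hmin _ (mem_nestVtx.2 ⟨e, he, Or.inr rfl⟩)) (not_le.2 (t.parent_childV_lt e))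
  have : nestVtx t N = insert r (N.image childV) := by
    ext v
    rw [Finset.mem_insert, Finset.mem_image]
    constructor
    · intro hv
      by_cases hvr : v = r
      · exact Or.inl hvr
      have hlt : r < v := lt_of_le_of_ne (hmin v hv) (Ne.symm hvr)
      obtain ⟨e, rfl⟩ := exists_childV_eq (v := v) (by have := Fin.lt_def.1 hlt; omega)
      refine Or.inr ⟨e, hN.path_subset hv hr ?_, rfl⟩
      rw [path_childV e hlt]
      exact Finset.mem_insert_self _ _
    · rintro (rfl | ⟨e, he, rfl⟩)
      · exact hr
      · exact mem_nestVtx.2 ⟨e, he, Or.inl rfl⟩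
  rw [this, Finset.card_insert_of_notMem hrN, Finset.card_image_of_injective _ childV_injective]

end Paths
section Nestings

variable {𝒩 : Finset (Finset (Fin (n - 1)))}

lemma minNest_subset {N : Finset (Fin (n - 1))} {i : Fin (n - 1)} (hN : N ∈ 𝒩) (hi : i ∈ N) :
    minNest 𝒩 i ⊆ N :=
  Finset.inf_le (f := id) (Finset.mem_filter.2 ⟨hN, hi⟩)

lemma mem_minNest (i : Fin (n - 1)) : i ∈ minNest 𝒩 i := by
  have : ({i} : Finset (Fin (n - 1))) ≤ minNest 𝒩 i :=
    Finset.le_inf fun N hN => Finset.singleton_subset_iff.2 (Finset.mem_filter.1 hN).2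
  exact this (Finset.mem_singleton_self i)

lemma minNest_mem (h : IsNesting t 𝒩) (i : Fin (n - 1)) : minNest 𝒩 i ∈ 𝒩 := by
  obtain ⟨N, hN, hmin⟩ := (𝒩.filter fun N => i ∈ N).exists_min_image Finset.card
    ⟨Finset.univ, Finset.mem_filter.2 ⟨h.2.1, Finset.mem_univ i⟩⟩
  obtain ⟨hN1, hN2⟩ := Finset.mem_filter.1 hN
  have : minNest 𝒩 i = N := by
    refine (minNest_subset hN1 hN2).antisymm (Finset.le_inf fun M hM => ?_)
    obtain ⟨hM1, hM2⟩ := Finset.mem_filter.1 hM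
    rcases h.2.2 N hN1 M hM1 with h' | h' | h'
    · exact h'
    · exact (Finset.eq_of_subset_of_card_le h' (hmin M hM)).ge
    · exact absurd hM2 (Finset.disjoint_left.1 h'.1 hN2)
  rwa [this]

lemma exists_subset_minNest (h : IsNesting t 𝒩) {S : Finset (Fin (n - 1))} (hS : t.Conn S)
    (hne : S.Nonempty) : ∃ i ∈ S, S ⊆ minNest 𝒩 i := by
  obtain ⟨i, hi, hmax⟩ := S.exists_max_image (fun i => (minNest 𝒩 i).card) hne
  refine ⟨i, hi, fun j hj => ?_⟩
  have := hS i hi j hj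
  clear hj
  induction this with
  | refl => exact mem_minNest i
  | @tail a b _ hab ih =>
    obtain ⟨ha, hb, hab⟩ := hab
    rcases h.2.2 _ (minNest_mem h i) _ (minNest_mem h b) with h' | h' | h'
    · rw [Finset.eq_of_subset_of_card_le h' (hmax b hb)]
      exact mem_minNest b
    · exact h' (mem_minNest b)
    · exact absurd hab (h'.2 a ih b (mem_minNest b))

lemma nest_nonempty (hn : 2 ≤ n) {N : Finset (Fin (n - 1))} (h : IsNest t N) : N.Nonempty := by
  rcases h.1 with h | rfl
  · exact h
  · exact ⟨⟨0, by omega⟩, Finset.mem_univ _⟩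

lemma image_minNest (hn : 2 ≤ n) (h : IsNesting t 𝒩) : Finset.univ.image (minNest 𝒩) = 𝒩 := by
  ext N
  simp only [Finset.mem_image, Finset.mem_univ, true_and]
  constructor
  · rintro ⟨i, rfl⟩
    exact minNest_mem h i
  · intro hN
    obtain ⟨i, hi, hsub⟩ := exists_subset_minNest h (h.1 N hN).2 (nest_nonempty hn (h.1 N hN))
    exact ⟨i, (minNest_subset hN hi).antisymm hsub⟩

lemma isMaxNesting_iff (hn : 2 ≤ n) (h : IsNesting t 𝒩) :
    IsMaxNesting t 𝒩 ↔ Function.Injective (minNest 𝒩) := by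
  rw [IsMaxNesting, and_iff_right h, ← Set.injOn_univ, ← Finset.coe_univ, ← Finset.card_image_iff,
    image_minNest hn h, Finset.card_univ, Fintype.card_fin]

/-- The ordered pairs of vertices of `t(min 𝒩(i))` separated by the edge `i`. -/
def crossing (t : PTree n) (𝒩 : Finset (Finset (Fin (n - 1)))) (i : Fin (n - 1)) :
    Finset (Fin n × Fin n) :=
  (nestVtx t (minNest 𝒩 i) ×ˢ nestVtx t (minNest 𝒩 i)).filter fun p => i ∈ t.path p.1 p.2

lemma mem_crossing {i : Fin (n - 1)} {p : Fin n × Fin n} : p ∈ t.crossing 𝒩 i ↔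
    (p.1 ∈ nestVtx t (minNest 𝒩 i) ∧ p.2 ∈ nestVtx t (minNest 𝒩 i)) ∧ i ∈ t.path p.1 p.2 := by
  rw [crossing, Finset.mem_filter, Finset.mem_product]

lemma two_mul_MPoint (i : Fin (n - 1)) :
    2 * MPoint t 𝒩 (fun _ => 1) i = (t.crossing 𝒩 i).card := by
  set V := nestVtx t (minNest 𝒩 i) with hV
  set A := V.filter fun w => isAnc t (childV i) w with hA
  set B := V.filter fun w => ¬ isAnc t (childV i) w with hB
  have hAB : Disjoint A B := Finset.disjoint_filter_filter_not _ _ _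
  have : t.crossing 𝒩 i = A ×ˢ B ∪ B ×ˢ A := by
    ext p
    simp only [mem_crossing, mem_path, Finset.mem_union, Finset.mem_product, hA, hB,
      Finset.mem_filter, ← hV]
    tauto
  rw [this, Finset.card_union_of_disjoint, Finset.card_product, Finset.card_product]
  · simp only [MPoint, alphaN, betaN, ← hV, ← hA, ← hB, Finset.sum_const]
    push_cast
    simp
    ring
  · exact Finset.disjoint_product.2 (Or.inl hAB)

/-- The lower bound for the sum of the coordinates indexed by the nest `N`. -/
def nestBound (N : Finset (Fin (n - 1))) : ℝ := (N.card : ℝ) * (N.card + 1) / 2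

lemma Conn.two_mul_nestBound {N : Finset (Fin (n - 1))} (hN : t.Conn N) (hne : N.Nonempty) :
    2 * nestBound N = ((nestVtx t N).offDiag.card : ℝ) := by
  rw [Finset.offDiag_card, hN.card_nestVtx hne, nestBound, Nat.cast_sub (Nat.le_mul_self _)]
  push_cast
  ring

lemma nestBound_le_sum_MPoint (hn : 2 ≤ n) (h : IsNesting t 𝒩) {N : Finset (Fin (n - 1))}
    (hN : IsNest t N) : nestBound N ≤ ∑ i ∈ N, MPoint t 𝒩 (fun _ => 1) i := by
  have hsub : (nestVtx t N).offDiag ⊆ N.biUnion (t.crossing 𝒩) := by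
    rintro ⟨u, w⟩ huw
    obtain ⟨hu, hw, hne⟩ := Finset.mem_offDiag.1 huw
    obtain ⟨hu', hw', hc⟩ := path_spec (t := t) hne
    obtain ⟨i, hi, hi'⟩ := exists_subset_minNest h hc
      (by obtain ⟨e, he, -⟩ := mem_nestVtx.1 hu'; exact ⟨e, he⟩)
    exact Finset.mem_biUnion.2 ⟨i, Conn.path_subset hN.2 hu hw hi,
      mem_crossing.2 ⟨⟨nestVtx_mono hi' hu', nestVtx_mono hi' hw'⟩, hi⟩⟩
  have hcard := (Finset.card_le_card hsub).trans Finset.card_biUnion_le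
  have : 2 * nestBound N ≤ 2 * ∑ i ∈ N, MPoint t 𝒩 (fun _ => 1) i := by
    rw [Conn.two_mul_nestBound hN.2 (nest_nonempty hn hN), Finset.mul_sum]
    simp only [two_mul_MPoint]
    exact_mod_cast hcard
  linarith

lemma sum_MPoint (hn : 2 ≤ n) (h : IsMaxNesting t 𝒩) {N : Finset (Fin (n - 1))}
    (hN : N ∈ 𝒩) : ∑ i ∈ N, MPoint t 𝒩 (fun _ => 1) i = nestBound N := by
  refine le_antisymm ?_ (nestBound_le_sum_MPoint hn h.1 (h.1.1 N hN))
  have hinj := (isMaxNesting_iff hn h.1).1 h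
  have hsub : N.biUnion (t.crossing 𝒩) ⊆ (nestVtx t N).offDiag := by
    rintro ⟨u, w⟩ huw
    obtain ⟨i, hi, hp⟩ := Finset.mem_biUnion.1 huw
    obtain ⟨⟨hu, hw⟩, hi'⟩ := mem_crossing.1 hp
    have hmin := minNest_subset hN hi
    refine Finset.mem_offDiag.2 ⟨nestVtx_mono hmin hu, nestVtx_mono hmin hw, ?_⟩
    rintro (rfl : u = w)
    simp [path_self] at hi'
  have hdisj : (N : Set (Fin (n - 1))).PairwiseDisjoint (t.crossing 𝒩) := by
    have key : ∀ i j p, p ∈ t.crossing 𝒩 i → p ∈ t.crossing 𝒩 j →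
        minNest 𝒩 j ⊆ minNest 𝒩 i := by
      intro i j p hi hj
      obtain ⟨⟨hu, hw⟩, -⟩ := mem_crossing.1 hi
      have hm := minNest_mem h.1 i
      exact minNest_subset hm (Conn.path_subset (h.1.1 _ hm).2 hu hw (mem_crossing.1 hj).2)
    intro i _ j _ hij
    refine Finset.disjoint_left.2 fun p hi hj => hij (hinj ?_)
    exact (key j i p hj hi).antisymm (key i j p hi hj)
  have hcard := Finset.card_le_card hsub
  rw [Finset.card_biUnion hdisj] at hcard
  have : 2 * ∑ i ∈ N, MPoint t 𝒩 (fun _ => 1) i ≤ 2 * nestBound N := by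
    rw [Conn.two_mul_nestBound (h.1.1 N hN).2 (nest_nonempty hn (h.1.1 N hN)), Finset.mul_sum]
    simp only [two_mul_MPoint]
    exact_mod_cast hcard
  linarith

/-- For a nesting, having zero sum over every nest amounts to having zero sum over every
class of edges sharing the same minimal nest. -/
lemma forall_sum_eq_zero_iff (h : IsNesting t 𝒩) (v : Vec (n - 1)) :
    (∀ N ∈ 𝒩, ∑ i ∈ N, v i = 0) ↔
      ∀ K, ∑ i with minNest 𝒩 i = K, v i = 0 := by
  have hmem : ∀ N ∈ 𝒩, ∀ i, i ∈ N ↔ minNest 𝒩 i ⊆ N := fun N hN i =>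
    ⟨fun hi => minNest_subset hN hi, fun hi => hi (mem_minNest i)⟩
  have hsum : ∀ N ∈ 𝒩, ∑ i ∈ N, v i =
      ∑ K ∈ N.powerset, ∑ i with minNest 𝒩 i = K, v i := by
    intro N hN
    rw [← Finset.sum_fiberwise_of_maps_to (s := N) (t := N.powerset) (g := minNest 𝒩)
      fun i hi => Finset.mem_powerset.2 ((hmem N hN i).1 hi)]
    refine Finset.sum_congr rfl fun K hK => Finset.sum_congr ?_ fun _ _ => rfl
    ext i
    simp only [Finset.mem_filter, Finset.mem_univ, true_and, and_iff_right_iff_imp]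
    rintro rfl
    exact (hmem N hN i).2 (Finset.mem_powerset.1 hK)
  constructor
  · intro hv K
    induction hk : K.card using Nat.strong_induction_on generalizing K with
    | _ k ih =>
    by_cases hK : K ∈ 𝒩
    · have := hsum K hK
      rw [hv K hK, Finset.sum_eq_single_of_mem K (Finset.mem_powerset_self K)] at this
      · exact this.symm
      · intro M hM hMK
        exact ih _ (hk ▸ Finset.card_lt_card
          ((Finset.mem_powerset.1 hM).ssubset_of_ne hMK)) M rfl
    · refine Finset.sum_eq_zero fun i hi => ?_
      exact absurd ((Finset.mem_filter.1 hi).2 ▸ minNest_mem h i) hK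
  · intro hv N hN
    rw [hsum N hN]
    exact Finset.sum_eq_zero fun K _ => hv K

end Nestings

section Polytope

/-- The polytope cut out by the nest inequalities. -/
def nestPolytope (t : PTree n) : Set (Vec (n - 1)) :=
  {x : Vec (n - 1) | (∀ N, IsNest t N → nestBound N ≤ ∑ i ∈ N, x i) ∧
    ∑ i, x i = nestBound (Finset.univ : Finset (Fin (n - 1)))}

open Classical in
/-- The nests whose inequality is an equality at `x`. -/
def tightNests (t : PTree n) (x : Vec (n - 1)) : Finset (Finset (Fin (n - 1))) :=
  Finset.univ.filter fun N => IsNest t N ∧ ∑ i ∈ N, x i = nestBound N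

lemma mem_tightNests {x : Vec (n - 1)} {N : Finset (Fin (n - 1))} :
    N ∈ t.tightNests x ↔ IsNest t N ∧ ∑ i ∈ N, x i = nestBound N := by
  simp [tightNests]

lemma isNest_univ : IsNest t Finset.univ := ⟨Or.inr rfl, conn_univ⟩

lemma isNesting_tightNests (hn : 2 ≤ n) {x : Vec (n - 1)} (hx : x ∈ t.nestPolytope) :
    IsNesting t (t.tightNests x) := by
  refine ⟨fun N hN => (mem_tightNests.1 hN).1, mem_tightNests.2 ⟨isNest_univ, hx.2⟩, ?_⟩
  intro N hN M hM
  obtain ⟨hN, hNx⟩ := mem_tightNests.1 hN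
  obtain ⟨hM, hMx⟩ := mem_tightNests.1 hM
  by_contra! hcon
  obtain ⟨hNM, hMN, hdisj⟩ := hcon
  have hun : IsNest t (N ∪ M) := by
    refine ⟨Or.inl ((nest_nonempty hn hN).mono Finset.subset_union_left), ?_⟩
    by_cases hd : Disjoint N M
    · obtain ⟨e, he, f, hf, hef⟩ := hdisj hd
      exact Conn.union hN.2 hM.2 he hf (Or.inr hef)
    · obtain ⟨e, he, he'⟩ := Finset.not_disjoint_iff.1 hd
      exact Conn.union hN.2 hM.2 he he' (Or.inl rfl)
  have hin : nestBound (N ∩ M) ≤ ∑ i ∈ N ∩ M, x i := by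
    rcases (N ∩ M).eq_empty_or_nonempty with h | h
    · simp [h, nestBound]
    · exact hx.1 _ ⟨Or.inl h, Conn.inter hN.2 hM.2⟩
  have hle := hx.1 _ hun
  have hsum := Finset.sum_union_inter (s₁ := N) (s₂ := M) (f := x)
  have hcard : ((N ∪ M).card : ℝ) + (N ∩ M).card = N.card + M.card := by
    exact_mod_cast Finset.card_union_add_card_inter N M
  have hltN : ((N ∩ M).card : ℝ) < N.card := by
    refine Nat.cast_lt.2 (Finset.card_lt_card (Finset.inter_subset_left.ssubset_of_ne ?_))
    exact fun h => hNM (Finset.inter_eq_left.1 h)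
  have hltM : ((N ∩ M).card : ℝ) < M.card := by
    refine Nat.cast_lt.2 (Finset.card_lt_card (Finset.inter_subset_right.ssubset_of_ne ?_))
    exact fun h => hMN (Finset.inter_eq_right.1 h)
  have hU : ((N ∪ M).card : ℝ) = N.card + M.card - (N ∩ M).card := by linarith
  unfold nestBound at *
  rw [hU] at hle
  nlinarith [mul_pos (sub_pos.2 hltN) (sub_pos.2 hltM)]

lemma convex_nestPolytope (t : PTree n) : Convex ℝ t.nestPolytope := by
  intro x hx y hy a b ha hb hab
  have hs : ∀ N : Finset (Fin (n - 1)), ∑ i ∈ N, (a • x + b • y) i =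
      a * ∑ i ∈ N, x i + b * ∑ i ∈ N, y i := by
    intro N
    simp [Finset.sum_add_distrib, Finset.mul_sum]
  refine ⟨fun N hN => ?_, ?_⟩
  · rw [hs]
    calc nestBound N = a * nestBound N + b * nestBound N := by rw [← add_mul, hab, one_mul]
      _ ≤ _ := by gcongr; exacts [hx.1 N hN, hy.1 N hN]
  · rw [hs, hx.2, hy.2, ← add_mul, hab, one_mul]

lemma isCompact_nestPolytope (t : PTree n) : IsCompact t.nestPolytope := by
  have hclosed : IsClosed t.nestPolytope := by
    refine IsClosed.inter (s₁ := {x : Vec (n - 1) | ∀ N, IsNest t N → nestBound N ≤ ∑ i ∈ N, x i})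
      (s₂ := {x : Vec (n - 1) | ∑ i, x i = nestBound (Finset.univ : Finset (Fin (n - 1)))}) ?_ ?_
    · simp only [Set.ofPred_forall]
      exact isClosed_iInter fun N => isClosed_iInter fun _ =>
        isClosed_le (by fun_prop) (by fun_prop)
    · exact isClosed_eq (by fun_prop) (by fun_prop)
  refine isCompact_Icc.of_isClosed_subset (s := Set.Icc 0 fun _ => nestBound (Finset.univ : Finset (Fin (n - 1))))
    hclosed fun x hx => ?_
  have h0 : ∀ i, 0 ≤ x i := by
    intro i
    have := hx.1 {i} ⟨Or.inl (Finset.singleton_nonempty i), conn_singleton i⟩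
    simp only [nestBound, Finset.card_singleton, Finset.sum_singleton] at this
    norm_num at this
    linarith
  refine ⟨h0, fun i => ?_⟩
  rw [← hx.2]
  exact Finset.single_le_sum (fun j _ => h0 j) (Finset.mem_univ i)

lemma eventually_add_smul_mem {x v : Vec (n - 1)} (hx : x ∈ t.nestPolytope)
    (hv : ∀ N ∈ t.tightNests x, ∑ i ∈ N, v i = 0) :
    ∀ᶠ s : ℝ in nhds 0, x + s • v ∈ t.nestPolytope := by
  have hs : ∀ (s : ℝ) (N : Finset (Fin (n - 1))), ∑ i ∈ N, (x + s • v) i =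
      ∑ i ∈ N, x i + s * ∑ i ∈ N, v i := by
    intro s N
    simp [Finset.sum_add_distrib, Finset.mul_sum]
  have hall : ∀ᶠ s : ℝ in nhds 0, ∀ N, IsNest t N → nestBound N ≤ ∑ i ∈ N, (x + s • v) i := by
    refine Filter.eventually_all.2 fun N => ?_
    by_cases hN : IsNest t N
    · rcases (hx.1 N hN).eq_or_lt with heq | hlt
      · refine .of_forall fun s _ => ?_
        rw [hs, hv N (mem_tightNests.2 ⟨hN, heq.symm⟩), heq, mul_zero, add_zero]
      · have hc : ContinuousAt (fun s : ℝ => ∑ i ∈ N, x i + s * ∑ i ∈ N, v i) 0 := by fun_prop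
        filter_upwards [hc.eventually (lt_mem_nhds (a := nestBound N) (by simpa using hlt))]
          with s h _
        rw [hs]
        exact h.le
    · exact .of_forall fun _ h => absurd h hN
  filter_upwards [hall] with s h
  refine ⟨h, ?_⟩
  rw [hs, hv _ (mem_tightNests.2 ⟨isNest_univ, hx.2⟩), mul_zero, add_zero, hx.2]

lemma sum_eq_zero_of_add_mem_of_sub_mem {x v : Vec (n - 1)} (h1 : x + v ∈ t.nestPolytope)
    (h2 : x - v ∈ t.nestPolytope) {N : Finset (Fin (n - 1))} (hN : N ∈ t.tightNests x) :
    ∑ i ∈ N, v i = 0 := by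
  obtain ⟨hN, hNx⟩ := mem_tightNests.1 hN
  have h1 := h1.1 N hN
  have h2 := h2.1 N hN
  simp only [Pi.add_apply, Pi.sub_apply, Finset.sum_add_distrib, Finset.sum_sub_distrib] at h1 h2
  linarith

lemma eq_zero_of_mem_extremePoints {x v : Vec (n - 1)}
    (hx : x ∈ Set.extremePoints ℝ t.nestPolytope)
    (hv : ∀ N ∈ t.tightNests x, ∑ i ∈ N, v i = 0) : v = 0 := by
  obtain ⟨ε, hε, h⟩ := Metric.eventually_nhds_iff.1 (eventually_add_smul_mem hx.1 hv)
  have h1 := h (y := ε / 2) (by rw [Real.dist_eq, sub_zero, abs_of_pos] <;> linarith)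
  have h2 := h (y := -(ε / 2)) (by rw [Real.dist_eq, sub_zero, abs_neg, abs_of_pos] <;> linarith)
  have := hx.2 h1 h2 ⟨1 / 2, 1 / 2, by norm_num, by norm_num, by norm_num, by module⟩
  simpa [hε.ne'] using this

lemma exists_eq_MPoint_of_mem_extremePoints (hn : 2 ≤ n) {x : Vec (n - 1)}
    (hx : x ∈ Set.extremePoints ℝ t.nestPolytope) :
    ∃ 𝒩, IsMaxNesting t 𝒩 ∧ x = MPoint t 𝒩 fun _ => 1 := by
  have hnest := isNesting_tightNests hn hx.1
  have hmax : IsMaxNesting t (t.tightNests x) := by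
    refine (isMaxNesting_iff hn hnest).2 fun i j hij => ?_
    by_contra hne
    have hz : (Pi.single i 1 - Pi.single j 1 : Vec (n - 1)) = 0 := by
      refine eq_zero_of_mem_extremePoints hx ((forall_sum_eq_zero_iff hnest _).2 fun K => ?_)
      simp [Finset.sum_sub_distrib, hij]
    have := congrFun hz i
    simp [hne] at this
  refine ⟨_, hmax, ?_⟩
  refine sub_eq_zero.1 (eq_zero_of_mem_extremePoints hx fun N hN => ?_)
  simp only [Pi.sub_apply, Finset.sum_sub_distrib]
  rw [(mem_tightNests.1 hN).2, sum_MPoint hn hmax hN, sub_self]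

/-- The facet description of the standard weight Loday realization. -/
lemma loday_eq_nestPolytope (hn : 2 ≤ n) : (Loday t fun _ => (1 : ℤ)) = t.nestPolytope := by
  apply Set.Subset.antisymm
  · refine convexHull_min ?_ t.convex_nestPolytope
    rintro _ ⟨𝒩, h𝒩, rfl⟩
    exact ⟨fun N hN => nestBound_le_sum_MPoint hn h𝒩.1 hN, sum_MPoint hn h𝒩 h𝒩.1.2.1⟩
  · rw [← closure_convexHull_extremePoints t.isCompact_nestPolytope t.convex_nestPolytope]
    have hfin : {x : Vec (n - 1) | ∃ 𝒩, IsMaxNesting t 𝒩 ∧ x = MPoint t 𝒩 fun _ => 1}.Finite := by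
      refine (Set.finite_range fun 𝒩 => MPoint t 𝒩 fun _ => 1).subset ?_
      rintro _ ⟨𝒩, -, rfl⟩
      exact ⟨𝒩, rfl⟩
    refine closure_minimal (convexHull_mono fun x hx => ?_) (hfin.isClosed_convexHull ℝ)
    exact exists_eq_MPoint_of_mem_extremePoints hn hx

end Polytope

end PTree

lemma mem_reflP_iff {m : ℕ} {z x : Vec m} {P : Set (Vec m)} :
    x ∈ reflP z P ↔ (2 : ℝ) • z - x ∈ P := by
  constructor
  · rintro ⟨y, hy, rfl⟩
    simpa using hy
  · intro h
    exact ⟨_, h, by simp⟩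

lemma dot_add_smul {m : ℕ} (c x v : Vec m) (s : ℝ) :
    dot c (x + s • v) = dot c x + s * dot c v := by
  simp only [dot, Pi.add_apply, Pi.smul_apply, smul_eq_mul, Finset.mul_sum,
    ← Finset.sum_add_distrib]
  exact Finset.sum_congr rfl fun i _ => by ring

lemma IsFace.midpoint_mem {m : ℕ} {R E : Set (Vec m)} (hE : IsFace R E) (hR : Convex ℝ R)
    {a b : Vec m} (ha : a ∈ E) (hb : b ∈ E) : midpoint ℝ a b ∈ E := by
  obtain ⟨c, rfl⟩ := hE
  refine ⟨hR.midpoint_mem ha.1 hb.1, fun y hy => ?_⟩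
  have h1 : midpoint ℝ a b = a + (1 / 2 : ℝ) • (b - a) := by
    rw [midpoint_eq_smul_add]
    norm_num
    module
  have h2 : b = a + (1 : ℝ) • (b - a) := by module
  have h3 := ha.2 b hb.1
  have h4 := hb.2 a ha.1
  have h5 := ha.2 y hy
  rw [h1, dot_add_smul]
  rw [h2, dot_add_smul] at h4
  linarith

lemma Convex.reflP {m : ℕ} {P : Set (Vec m)} (hP : Convex ℝ P) (z : Vec m) :
    Convex ℝ (reflP z P) := by
  intro x hx y hy a b ha hb hab
  rw [mem_reflP_iff] at hx hy ⊢
  convert hP hx hy ha hb hab using 1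
  obtain rfl : b = 1 - a := by linarith
  module

/-- A vector along which one can move both ways inside `R` from a point of a face of `R` is
parallel to that face. -/
lemma IsFace.mem_direction_of_eventually {m : ℕ} {R E : Set (Vec m)} (hE : IsFace R E)
    {x v : Vec m} (hx : x ∈ E) (hv : ∀ᶠ s : ℝ in nhds 0, x + s • v ∈ R) :
    v ∈ (affineSpan ℝ E).direction := by
  obtain ⟨c, rfl⟩ := hE
  obtain ⟨ε, hε, h⟩ := Metric.eventually_nhds_iff.1 hv
  have h1 := h (y := ε / 2) (by rw [Real.dist_eq, sub_zero, abs_of_pos] <;> linarith)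
  have h2 := h (y := -(ε / 2)) (by rw [Real.dist_eq, sub_zero, abs_neg, abs_of_pos] <;> linarith)
  have h3 := hx.2 _ h1
  have h4 := hx.2 _ h2
  rw [dot_add_smul] at h3 h4
  have hcv : dot c v = 0 := by nlinarith
  have h5 : x + (ε / 2) • v ∈ {x ∈ R | ∀ y ∈ R, dot c y ≤ dot c x} := by
    refine ⟨h1, fun y hy => ?_⟩
    rw [dot_add_smul, hcv, mul_zero, add_zero]
    exact hx.2 y hy
  have h6 := AffineSubspace.vsub_mem_direction (subset_affineSpan ℝ _ h5)
    (subset_affineSpan ℝ _ hx)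
  rw [vsub_eq_sub, add_sub_cancel_left] at h6
  exact (Submodule.smul_mem_iff _ (by positivity)).1 h6

/-- For the standard weight Loday realization `P = P_t ⊆ ℝ^{n-1}` of the
operahedron of a planar tree `t ∈ PT_n`, every direction of an edge of `P ∩ ρ_z P`, over all
`z ∈ P`, is a nonzero scalar multiple of a trinary vector with the same number of coordinates
equal to `1` and to `-1` and whose first nonzero coordinate is `1`. -/
theorem stmt15 {n : ℕ} (t : PTree n) :
    ∀ d : Vec (n - 1), EdgeDir (Loday t fun _ => (1 : ℤ)) d →
      ∃ (c : ℝ) (u : Vec (n - 1)), c ≠ 0 ∧ Trinary u ∧ BalancedVec u ∧ FirstPos u ∧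
        d = c • u := by
  intro d hd
  obtain ⟨hd0, z, -, E, ⟨hE, hdim⟩, hdE⟩ := hd
  have hn : 2 ≤ n := by
    by_contra hn
    obtain ⟨i, -⟩ := Function.ne_iff.1 hd0
    have := i.isLt
    omega
  rw [PTree.loday_eq_nestPolytope hn] at hE
  obtain ⟨a, ha, b, hb, hab⟩ : ∃ a ∈ E, ∃ b ∈ E, a ≠ b := by
    by_contra! h
    have hbot : vectorSpan ℝ E = ⊥ := vectorSpan_of_subsingleton ℝ h
    rw [sdim, direction_affineSpan, hbot, finrank_bot] at hdim
    omega
  have hmem : ∀ x ∈ E, x ∈ t.nestPolytope ∧ (2 : ℝ) • z - x ∈ t.nestPolytope := by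
    intro x hx
    obtain ⟨c, rfl⟩ := hE
    exact ⟨hx.1.1, mem_reflP_iff.1 hx.1.2⟩
  set x : Vec (n - 1) := midpoint ℝ a b with hxdef
  set w : Vec (n - 1) := (1 / 2 : ℝ) • (b - a) with hwdef
  have hxw : x + w = b := by rw [hxdef, hwdef, midpoint_eq_smul_add]; norm_num; module
  have hxw' : x - w = a := by rw [hxdef, hwdef, midpoint_eq_smul_add]; norm_num; module
  have hw : w ≠ 0 := by simp [hwdef, sub_eq_zero, hab.symm]
  have hxE : x ∈ E :=
    hE.midpoint_mem (t.convex_nestPolytope.inter (t.convex_nestPolytope.reflP z)) ha hb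
  have hxP := (hmem x hxE).1
  have hyP := (hmem x hxE).2
  have hxN := PTree.isNesting_tightNests hn hxP
  have hyN := PTree.isNesting_tightNests hn hyP
  obtain ⟨u, hu0, hu, hux, huy⟩ := exists_trinary_of_sum_fiber_eq_zero
    (minNest (t.tightNests x)) (minNest (t.tightNests ((2 : ℝ) • z - x))) hw
    ((PTree.forall_sum_eq_zero_iff hxN w).1 fun N hN =>
      PTree.sum_eq_zero_of_add_mem_of_sub_mem (hxw ▸ (hmem b hb).1) (hxw' ▸ (hmem a ha).1) hN)
    ((PTree.forall_sum_eq_zero_iff hyN w).1 fun N hN =>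
      PTree.sum_eq_zero_of_add_mem_of_sub_mem
        (by rw [sub_add, hxw']; exact (hmem a ha).2)
        (by rw [sub_sub, hxw]; exact (hmem b hb).2) hN)
  rw [← PTree.forall_sum_eq_zero_iff hxN] at hux
  rw [← PTree.forall_sum_eq_zero_iff hyN] at huy
  have huE : u ∈ (affineSpan ℝ E).direction := by
    refine hE.mem_direction_of_eventually hxE ?_
    have huy' : ∀ N ∈ t.tightNests ((2 : ℝ) • z - x), ∑ i ∈ N, (-u) i = 0 := fun N hN => by
      simp [huy N hN]
    filter_upwards [PTree.eventually_add_smul_mem hxP hux,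
      PTree.eventually_add_smul_mem hyP huy'] with s h1 h2
    refine ⟨h1, mem_reflP_iff.2 ?_⟩
    convert h2 using 1
    module
  obtain ⟨c, hc⟩ := (finrank_eq_one_iff_of_nonzero' (⟨u, huE⟩ : (affineSpan ℝ E).direction)
    (by simpa using hu0)).1 hdim ⟨d, hdE⟩
  replace hc : c • u = d := congrArg Subtype.val hc
  have hc0 : c ≠ 0 := by
    rintro rfl
    exact hd0 (by rw [← hc, zero_smul])
  have hbal : ∑ i, u i = 0 := hux _ hxN.2.1
  rcases hu.firstPos_or_firstPos_neg with h | h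
  · exact ⟨c, u, hc0, hu, balancedVec_of_sum_eq_zero hu hbal, h, hc.symm⟩
  · exact ⟨-c, -u, neg_ne_zero.2 hc0, hu.neg,
      balancedVec_of_sum_eq_zero hu.neg (by simp [hbal]), h, by rw [neg_smul_neg, hc]⟩

end
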